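/- Let V be a variety that has a weak difference term. Then for every algebra A ∈ V and all congruences α, β on A, the quotient α/(α⊓β) is abelian if and only if the perspective quotient (α⊔β)/β is abelian; that is, C(α,α;α⊓β) holds if and only if C(α⊔β,α⊔β;β) holds. -/

import Mathlib

open FirstOrder.Language FirstOrder.Language.Structure

universe u v w

/-- A binary relation on `A` is compatible with all (interpreted) operations of the
`L`-structure `A`. -/
def Compatible (L : FirstOrder.Language.{u, v}) (A : Type w) [L.Structure A]
    (T : A → A → Prop) : Prop :=
  ∀ (n : ℕ) (f : L.Functions n) (a b : Fin n → A),
    (∀ i, T (a i) (b i)) → T (funMap f a) (funMap f b)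

/-- A tolerance on `A`: a reflexive, symmetric, compatible binary relation. -/
def IsTolerance (L : FirstOrder.Language.{u, v}) (A : Type w) [L.Structure A]
    (T : A → A → Prop) : Prop :=
  Reflexive T ∧ Symmetric T ∧ Compatible L A T

/-- A congruence on `A`: a transitive tolerance. -/
def IsCongruence (L : FirstOrder.Language.{u, v}) (A : Type w) [L.Structure A]
    (T : A → A → Prop) : Prop :=
  IsTolerance L A T ∧ Transitive T

/-- The centralizer condition `C(S, T; δ)`: for every term `t(x, y₁, …, yₙ)`
(variable `0` playing the role of `x`), every `(a, b) ∈ S` and all pairs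
`(uᵢ, vᵢ) ∈ T`, if `(t(a, ū), t(a, v̄)) ∈ δ` then `(t(b, ū), t(b, v̄)) ∈ δ`. -/
def Centralizes (L : FirstOrder.Language.{u, v}) (A : Type w) [L.Structure A]
    (S T δ : A → A → Prop) : Prop :=
  ∀ (n : ℕ) (t : L.Term (Fin (n + 1))) (a b : A), S a b →
    ∀ u v : Fin n → A, (∀ i, T (u i) (v i)) →
      (δ (t.realize (Fin.cons a u)) (t.realize (Fin.cons a v)) →
        δ (t.realize (Fin.cons b u)) (t.realize (Fin.cons b v)))

/-- The algebra `A` satisfies every equation in the set `E` under every assignment: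
membership in the variety axiomatized by `E`. -/
def SatisfiesEqs (L : FirstOrder.Language.{u, v}) (A : Type w) [L.Structure A]
    (E : Set (Σ n : ℕ, L.Term (Fin n) × L.Term (Fin n))) : Prop :=
  ∀ e ∈ E, ∀ val : Fin e.1 → A, e.2.1.realize val = e.2.2.realize val

/-- `wt` is a weak difference term for the variety axiomatized by `E`: for every
algebra `A` in the variety, every abelian congruence `α` on `A`, and every
`(a, b) ∈ α`, `wt(a, a, b) = b` and `wt(b, a, a) = b`. -/
def IsWeakDifferenceTerm (L : FirstOrder.Language.{u, v})
    (E : Set (Σ n : ℕ, L.Term (Fin n) × L.Term (Fin n))) (wt : L.Term (Fin 3)) : Prop :=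
  ∀ (A : Type w) [L.Structure A], SatisfiesEqs L A E →
    ∀ α : A → A → Prop, IsCongruence L A α → Centralizes L A α α Eq →
      ∀ a b : A, α a b → wt.realize ![a, a, b] = b ∧ wt.realize ![b, a, a] = b

/-- The variety axiomatized by `E` has a Taylor term: an idempotent term
`t(x₁, …, xₙ)`, `n ≥ 1`, such that for each `i` the variety satisfies an identity
`t(w₁, …, wₙ) ≈ t(z₁, …, zₙ)` with `wᵢ ≠ zᵢ` (variables indexed by `ℕ`). -/
def HasTaylorTerm (L : FirstOrder.Language.{u, v})
    (E : Set (Σ n : ℕ, L.Term (Fin n) × L.Term (Fin n))) : Prop :=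
  ∃ (n : ℕ) (t : L.Term (Fin n)), 0 < n ∧
    (∀ (A : Type w) [L.Structure A], SatisfiesEqs L A E →
      ∀ a : A, t.realize (fun _ => a) = a) ∧
    (∀ i : Fin n, ∃ wv zv : Fin n → ℕ, wv i ≠ zv i ∧
      ∀ (A : Type w) [L.Structure A], SatisfiesEqs L A E →
        ∀ val : ℕ → A, t.realize (val ∘ wv) = t.realize (val ∘ zv))

open FirstOrder

section Realize

variable {L : FirstOrder.Language.{u, v}} {A : Type w} [L.Structure A]

theorem Compatible.realize {T : A → A → Prop} (hT : Compatible L A T) {σ : Type*}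
    (t : L.Term σ) {a b : σ → A} (h : ∀ i, T (a i) (b i)) : T (t.realize a) (t.realize b) := by
  induction t with
  | var i => exact h i
  | func f ts ih => exact hT _ f _ _ ih

theorem Compatible.comp {S T : A → A → Prop} (hS : Compatible L A S) (hT : Compatible L A T) :
    Compatible L A (Relation.Comp S T) := by
  intro n f a b h
  choose c hac hcb using h
  exact ⟨_, hS n f a c hac, hT n f c b hcb⟩

theorem IsTolerance.comp_self {T : A → A → Prop} (hT : IsTolerance L A T) :
    IsTolerance L A (Relation.Comp T T) :=
  ⟨fun x => ⟨x, hT.1 x, hT.1 x⟩, fun _ _ ⟨z, hxz, hzy⟩ => ⟨z, hT.2.1 hzy, hT.2.1 hxz⟩,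
    hT.2.2.comp hT.2.2⟩

theorem IsCongruence.inf {α β : A → A → Prop} (hα : IsCongruence L A α)
    (hβ : IsCongruence L A β) : IsCongruence L A (fun a b => α a b ∧ β a b) :=
  ⟨⟨fun x => ⟨hα.1.1 x, hβ.1.1 x⟩, fun _ _ h => ⟨hα.1.2.1 h.1, hβ.1.2.1 h.2⟩,
    fun n f a b h => ⟨hα.1.2.2 n f a b fun i => (h i).1, hβ.1.2.2 n f a b fun i => (h i).2⟩⟩,
    fun _ _ _ h k => ⟨hα.2 h.1 k.1, hβ.2 h.2 k.2⟩⟩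

end Realize

section QuotientAlgebra

variable {L : FirstOrder.Language.{u, v}} {A : Type w} [L.Structure A]

/-- The setoid of a congruence. -/
def IsCongruence.setoid {δ : A → A → Prop} (hδ : IsCongruence L A δ) : Setoid A :=
  ⟨δ, hδ.1.1, fun h => hδ.1.2.1 h, fun h k => hδ.2 h k⟩

/-- The operations induced on the quotient of an algebra by a congruence. -/
noncomputable abbrev IsCongruence.quotientStructure {δ : A → A → Prop}
    (hδ : IsCongruence L A δ) : L.Structure (Quotient hδ.setoid) where
  funMap f x := Quotient.mk _ (funMap f fun i => (x i).out)
  RelMap _ _ := False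

theorem IsCongruence.realize_mk {δ : A → A → Prop} (hδ : IsCongruence L A δ) {σ : Type*}
    (t : L.Term σ) (a : σ → A) :
    letI := hδ.quotientStructure
    t.realize (fun i => Quotient.mk hδ.setoid (a i)) = Quotient.mk hδ.setoid (t.realize a) := by
  let := hδ.quotientStructure
  induction t with
  | var i => rfl
  | func f ts ih =>
    refine Quotient.sound (hδ.1.2.2 _ f _ _ fun i => ?_)
    exact Quotient.exact (s := hδ.setoid) ((Quotient.out_eq _).trans (ih i))

theorem IsCongruence.satisfiesEqs_quotient {δ : A → A → Prop} (hδ : IsCongruence L A δ)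
    {E : Set (Σ n : ℕ, L.Term (Fin n) × L.Term (Fin n))} (hE : SatisfiesEqs L A E) :
    letI := hδ.quotientStructure
    SatisfiesEqs L (Quotient hδ.setoid) E := by
  intro e he val
  obtain ⟨a, rfl⟩ : ∃ a : Fin e.1 → A, (fun i => Quotient.mk hδ.setoid (a i)) = val :=
    ⟨fun i => (val i).out, funext fun i => Quotient.out_eq _⟩
  rw [hδ.realize_mk, hδ.realize_mk, hE e he a]

/-- A weak difference term is Maltsev modulo `δ` on the blocks of a congruence that is abelian
over `δ`. -/
theorem IsWeakDifferenceTerm.maltsev_of_centralizes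
    {E : Set (Σ n : ℕ, L.Term (Fin n) × L.Term (Fin n))} {d : L.Term (Fin 3)}
    (hd : IsWeakDifferenceTerm.{u, v, w} L E d) (hE : SatisfiesEqs L A E)
    {α δ : A → A → Prop} (hα : IsCongruence L A α) (hδ : IsCongruence L A δ)
    (hle : ∀ a b, δ a b → α a b) (hC : Centralizes L A α α δ) {a b : A} (hab : α a b) :
    δ (d.realize ![a, a, b]) b ∧ δ (d.realize ![b, a, a]) b := by
  let := hδ.quotientStructure
  let mk : A → Quotient hδ.setoid := Quotient.mk hδ.setoid
  have mk_eq : ∀ {x y}, mk x = mk y ↔ δ x y := fun {x y} =>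
    ⟨fun h => Quotient.exact h, fun h => Quotient.sound (s := hδ.setoid) h⟩
  let γ : Quotient hδ.setoid → Quotient hδ.setoid → Prop := fun x y => α x.out y.out
  have out_mk : ∀ x, α (mk x).out x := fun x => hle _ _ (Quotient.mk_out (s := hδ.setoid) x)
  have mk_out : ∀ x, mk x.out = x := fun x => Quotient.out_eq x
  have γ_mk : ∀ {x y}, α x y → γ (mk x) (mk y) := fun {x y} h =>
    hα.2 (out_mk x) (hα.2 h (hα.1.2.1 (out_mk y)))
  have hγ : IsCongruence L (Quotient hδ.setoid) γ :=
    ⟨⟨fun x => hα.1.1 _, fun x y h => hα.1.2.1 h,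
      fun n f x y h => γ_mk (hα.1.2.2 n f _ _ h)⟩, fun x y z h k => hα.2 h k⟩
  have realize_cons : ∀ (n : ℕ) (t : L.Term (Fin (n + 1))) (x : Quotient hδ.setoid)
      (u : Fin n → Quotient hδ.setoid), t.realize (Fin.cons x u : Fin (n + 1) → _) =
        mk (t.realize (Fin.cons x.out fun i => (u i).out : Fin (n + 1) → A)) := by
    intro n t x u
    refine Eq.trans ?_ (hδ.realize_mk _ _)
    congr 1
    funext i
    refine Fin.cases ?_ (fun i => ?_) i
    · exact (mk_out x).symm
    · exact (mk_out (u i)).symm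
  have hab' : Centralizes L (Quotient hδ.setoid) γ γ Eq := by
    intro n t x y hxy p q hpq h
    rw [realize_cons, realize_cons, mk_eq] at h ⊢
    exact hC n t _ _ hxy _ _ hpq h
  have realize_vec : ∀ x y z : A, d.realize ![mk x, mk y, mk z] = mk (d.realize ![x, y, z]) := by
    intro x y z
    refine Eq.trans ?_ (hδ.realize_mk _ _)
    congr 1
    funext i
    fin_cases i <;> rfl
  have := hd _ (hδ.satisfiesEqs_quotient hE) γ hγ hab' _ _ (γ_mk hab)
  rwa [realize_vec, realize_vec, mk_eq, mk_eq] at this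

end QuotientAlgebra

section TermCondition

variable {L : FirstOrder.Language.{u, v}} {A : Type w} [L.Structure A]

variable (L) in
/-- The term condition for `C(T, T; δ)` with tuples in both groups of variables. -/
def TermCondition (T δ : A → A → Prop) : Prop :=
  ∀ (σ τ : Type) [Finite σ] [Finite τ] (t : L.Term (σ ⊕ τ)) (a b : σ → A) (p q : τ → A),
    (∀ i, T (a i) (b i)) → (∀ j, T (p j) (q j)) →
      δ (t.realize (Sum.elim a p)) (t.realize (Sum.elim a q)) →
        δ (t.realize (Sum.elim b p)) (t.realize (Sum.elim b q))

theorem TermCondition.centralizes {T δ : A → A → Prop} (h : TermCondition L T δ) :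
    Centralizes L A T T δ := by
  intro n t a b hab p q hpq
  have key : ∀ (c : A) (r : Fin n → A), t.realize (Fin.cons c r : Fin (n + 1) → A) =
      (t.relabel (Fin.cons (Sum.inl ()) Sum.inr : Fin (n + 1) → Unit ⊕ Fin n)).realize
        (Sum.elim (fun _ => c) r) := by
    intro c r
    rw [Term.realize_relabel]
    congr 1
    funext i
    refine Fin.cases ?_ (fun i => ?_) i <;> rfl
  rw [key, key, key, key]
  exact h _ _ _ _ _ _ _ (fun _ => hab) hpq

theorem Centralizes.update {T δ : A → A → Prop}
    (h : Centralizes L A T T δ) {ι : Type} [Finite ι] [DecidableEq ι] (t : L.Term ι) (i : ι)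
    {b : A} {p q : ι → A} (hi : p i = q i) (hb : T (p i) b) (hpq : ∀ j, T (p j) (q j))
    (hδ : δ (t.realize p) (t.realize q)) :
    δ (t.realize (Function.update p i b)) (t.realize (Function.update q i b)) := by
  obtain ⟨n, ⟨e⟩⟩ := Finite.exists_equiv_fin ι
  let f : ι → Fin (n + 1) := fun j => if j = i then 0 else (e j).succ
  have key : ∀ (c : A) (r : ι → A), t.realize (Function.update r i c) =
      (t.relabel f).realize (Fin.cons c (r ∘ e.symm) : Fin (n + 1) → A) := by
    intro c r
    rw [Term.realize_relabel]
    congr 1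
    funext j
    by_cases hj : j = i
    · subst hj; simp [f]
    · simp [f, hj]
  have hp := key (p i) p
  have hq := key (p i) q
  rw [Function.update_eq_self] at hp
  rw [hi, Function.update_eq_self] at hq
  rw [key, key]
  refine h n _ (p i) b hb _ _ (fun j => hpq _) ?_
  rwa [← hp, hi, ← hq]

theorem Centralizes.termCondition {T δ : A → A → Prop} (hT : ∀ x, T x x)
    (h : Centralizes L A T T δ) : TermCondition L T δ := by
  classical
  intro σ τ _ _ t a b p q hab hpq h0
  have key : ∀ s : Finset σ,
      δ (t.realize (Sum.elim (s.piecewise b a) p)) (t.realize (Sum.elim (s.piecewise b a) q)) := by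
    intro s
    induction s using Finset.induction_on with
    | empty => simpa using h0
    | insert i s hi ih =>
      have := h.update t (Sum.inl i) (b := b i) (p := Sum.elim (s.piecewise b a) p)
        (q := Sum.elim (s.piecewise b a) q) rfl (by simpa [hi] using hab i)
        (by rintro (j | j); exacts [hT _, hpq j]) ih
      rwa [Sum.update_elim_inl, Sum.update_elim_inl, ← Finset.piecewise_insert] at this
  have := Fintype.ofFinite σ
  simpa using key Finset.univ

theorem TermCondition.mod {α β : A → A → Prop} (hα : IsCongruence L A α)
    (hβ : IsCongruence L A β) (h : TermCondition L α (fun a b => α a b ∧ β a b)) :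
    TermCondition L (Relation.Comp β (Relation.Comp α β)) β := by
  intro σ τ _ _ t a b p q hab hpq h0
  choose a' haa b' hab' hbb using hab
  choose p' hpp q' hpq' hqq using hpq
  have symm := fun {x y} (h : β x y) => hβ.1.2.1 h
  have cong : ∀ {x y : σ → A} {z w : τ → A}, (∀ i, β (x i) (y i)) → (∀ j, β (z j) (w j)) →
      β (t.realize (Sum.elim x z)) (t.realize (Sum.elim y w)) := fun hx hz =>
    hβ.1.2.2.realize t (by rintro (i | j); exacts [hx i, hz j])
  have h1 := h σ τ t a' b' p' q' hab' hpq'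
    ⟨hα.1.2.2.realize t (by rintro (i | j); exacts [hα.1.1 _, hpq' j]),
      hβ.2 (symm (cong haa hpp)) (hβ.2 h0 (cong haa fun j => symm (hqq j)))⟩
  exact hβ.2 (symm (cong hbb fun j => symm (hpp j))) (hβ.2 h1.2 (cong hbb hqq))

/-- A tolerance that is abelian over `δ` and on which `d` is a Maltsev operation modulo `δ`. -/
structure IsAffineTolerance (d : L.Term (Fin 3)) (T δ : A → A → Prop) : Prop where
  isTolerance : IsTolerance L A T
  termCondition : TermCondition L T δ
  left : ∀ {a b}, T a b → δ (d.realize ![a, a, b]) b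
  right : ∀ {a b}, T a b → δ (d.realize ![b, a, a]) b

theorem IsAffineTolerance.realize_difference {d : L.Term (Fin 3)} {T δ : A → A → Prop}
    (hδ : IsCongruence L A δ) (h : IsAffineTolerance d T δ) {σ τ : Type} [Finite σ] [Finite τ]
    (t : L.Term (σ ⊕ τ)) {a b : σ → A} {p q : τ → A} (hab : ∀ i, T (a i) (b i))
    (hpq : ∀ j, T (p j) (q j)) :
    δ (d.realize ![t.realize (Sum.elim a p), t.realize (Sum.elim a q),
      t.realize (Sum.elim b q)]) (t.realize (Sum.elim b p)) := by
  have refl := h.isTolerance.1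
  have cong : ∀ {x y : σ → A} {z w : τ → A}, (∀ i, T (x i) (y i)) → (∀ j, T (z j) (w j)) →
      T (t.realize (Sum.elim x z)) (t.realize (Sum.elim y w)) := fun hx hz =>
    h.isTolerance.2.2.realize t (by rintro (i | j); exacts [hx i, hz j])
  let F : L.Term (τ ⊕ (σ ⊕ (σ ⊕ τ))) := d.subst
    ![t.relabel (Sum.elim (Sum.inr ∘ Sum.inl) Sum.inl),
      t.relabel (Sum.elim (Sum.inr ∘ Sum.inl) (Sum.inr ∘ Sum.inr ∘ Sum.inr)),
      t.relabel (Sum.inr ∘ Sum.inr)]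
  have hF : ∀ (y : τ → A) (x : σ → A),
      F.realize (Sum.elim y (Sum.elim x (Sum.elim b q))) =
        d.realize ![t.realize (Sum.elim x y), t.realize (Sum.elim x q),
          t.realize (Sum.elim b q)] := by
    intro y x
    rw [Term.realize_subst]
    congr 1
    funext i
    fin_cases i <;>
    · simp only [Matrix.cons_val, Fin.isValue, Fin.zero_eta, Fin.mk_one, Fin.reduceFinMk,
        Term.realize_relabel]
      congr 1
      try funext j; cases j <;> rfl
  have key := h.termCondition _ _ F q p (Sum.elim a (Sum.elim b q)) (Sum.elim b (Sum.elim b q))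
    (fun j => h.isTolerance.2.1 (hpq j))
    (by rintro (i | i | j); exacts [hab i, refl _, refl _])
  rw [hF, hF, hF, hF] at key
  exact hδ.2 (key (hδ.2 (h.left (cong hab fun j => refl _)) (hδ.1.2.1 (h.left (refl _)))))
    (h.right (cong (fun i => refl _) fun j => h.isTolerance.2.1 (hpq j)))

theorem IsAffineTolerance.comp_self {d : L.Term (Fin 3)} {T δ : A → A → Prop}
    (hδ : IsCongruence L A δ) (h : IsAffineTolerance d T δ) :
    IsAffineTolerance d (Relation.Comp T T) δ where
  isTolerance := h.isTolerance.comp_self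
  termCondition := by
    intro σ τ _ _ t a b p q hab hpq h0
    choose c hac hcb using hab
    choose r hpr hrq using hpq
    have step : ∀ {x y : σ → A}, (∀ i, T (x i) (y i)) →
        δ (t.realize (Sum.elim x p)) (t.realize (Sum.elim x q)) →
        δ (t.realize (Sum.elim y p)) (t.realize (Sum.elim y q)) := by
      intro x y hxy hx
      have h1 := h.realize_difference hδ t hxy hpr
      have h2 := h.realize_difference hδ t hxy fun j => h.isTolerance.2.1 (hrq j)
      refine hδ.2 (hδ.1.2.1 h1) (hδ.2 (hδ.1.2.2.realize d fun i => ?_) h2)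
      fin_cases i
      exacts [hx, hδ.1.1 _, hδ.1.1 _]
    exact step hcb (step hac h0)
  left := by
    rintro x z ⟨y, hxy, hyz⟩
    have hF : ∀ r s : A, (d.relabel ![Sum.inr (), Sum.inr (), Sum.inl ()]).realize
        (Sum.elim (fun _ : Unit => r) fun _ : Unit => s) = d.realize ![s, s, r] := by
      intro r s
      rw [Term.realize_relabel]
      congr 1
      funext i
      fin_cases i <;> rfl
    have key := h.termCondition Unit Unit (d.relabel ![Sum.inr (), Sum.inr (), Sum.inl ()])
      (fun _ => y) (fun _ => z) (fun _ => x) (fun _ => y) (fun _ => hyz) (fun _ => hxy)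
    rw [hF, hF, hF, hF] at key
    exact hδ.2 (key (hδ.2 (h.left hxy) (hδ.1.2.1 (h.left (h.isTolerance.1 y))))) (h.left hyz)
  right := by
    rintro x z ⟨y, hxy, hyz⟩
    have hF : ∀ r s : A, (d.relabel ![Sum.inl (), Sum.inr (), Sum.inr ()]).realize
        (Sum.elim (fun _ : Unit => r) fun _ : Unit => s) = d.realize ![r, s, s] := by
      intro r s
      rw [Term.realize_relabel]
      congr 1
      funext i
      fin_cases i <;> rfl
    have key := h.termCondition Unit Unit (d.relabel ![Sum.inl (), Sum.inr (), Sum.inr ()])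
      (fun _ => y) (fun _ => z) (fun _ => x) (fun _ => y) (fun _ => hyz) (fun _ => hxy)
    rw [hF, hF, hF, hF] at key
    exact hδ.2 (key (hδ.2 (h.right hxy) (hδ.1.2.1 (h.right (h.isTolerance.1 y))))) (h.right hyz)

/-- The transitive closure of an affine tolerance is abelian. -/
theorem IsAffineTolerance.centralizes_transGen {d : L.Term (Fin 3)} {T δ : A → A → Prop}
    (hδ : IsCongruence L A δ) (h : IsAffineTolerance d T δ) :
    Centralizes L A (Relation.TransGen T) (Relation.TransGen T) δ := by
  let S : ℕ → A → A → Prop := fun n => (fun R => Relation.Comp R R)^[n] T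
  have S_succ : ∀ n, S (n + 1) = Relation.Comp (S n) (S n) := fun n =>
    Function.iterate_succ_apply' _ _ _
  have hS : ∀ n, IsAffineTolerance d (S n) δ := by
    intro n
    induction n with
    | zero => exact h
    | succ n ih => rw [S_succ]; exact ih.comp_self hδ
  have S_mono : Monotone S := by
    refine monotone_nat_of_le_succ fun n x y hxy => ?_
    rw [S_succ]
    exact ⟨y, hxy, (hS n).isTolerance.1 y⟩
  have exists_S : ∀ {x y}, Relation.TransGen T x y → ∃ n, S n x y := by
    intro x y hxy
    induction hxy with
    | single hxy => exact ⟨0, hxy⟩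
    | tail _ hyz ih =>
      obtain ⟨n, hn⟩ := ih
      refine ⟨n + 1, ?_⟩
      rw [S_succ]
      exact ⟨_, hn, S_mono (Nat.zero_le n) _ _ hyz⟩
  intro n t a b hab p q hpq
  obtain ⟨k, hk⟩ := exists_S hab
  choose m hm using fun i => exists_S (hpq i)
  let N := max k (Finset.univ.sup m)
  exact (hS N).termCondition.centralizes n t a b (S_mono (le_max_left _ _) _ _ hk) p q fun i =>
    S_mono ((Finset.le_sup (Finset.mem_univ i)).trans (le_max_right _ _)) _ _ (hm i)

end TermCondition

theorem Centralizes.mono {L : FirstOrder.Language.{u, v}} {A : Type w} [L.Structure A]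
    {S S' T T' δ : A → A → Prop} (hS : ∀ a b, S a b → S' a b) (hT : ∀ a b, T a b → T' a b)
    (h : Centralizes L A S' T' δ) : Centralizes L A S T δ :=
  fun n t a b hab p q hpq => h n t a b (hS a b hab) p q fun i => hT _ _ (hpq i)

theorem Centralizes.inf_self {L : FirstOrder.Language.{u, v}} {A : Type w} [L.Structure A]
    {S α β : A → A → Prop} (hα : IsCongruence L A α) (h : Centralizes L A S α β) :
    Centralizes L A S α (fun a b => α a b ∧ β a b) := fun n t a b hab p q hpq h0 =>
  ⟨hα.1.2.2.realize t fun i => Fin.cases (hα.1.1 b) hpq i, h n t a b hab p q hpq h0.2⟩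

/-- In a variety with a weak difference term, perspective congruence quotients are
simultaneously abelian: `C(α, α; α ⊓ β)` holds iff `C(α ⊔ β, α ⊔ β; β)` holds. -/
theorem perspective_quotients_abelian_iff {L : FirstOrder.Language.{u, v}}
    (E : Set (Σ n : ℕ, L.Term (Fin n) × L.Term (Fin n)))
    (hW : ∃ wt : L.Term (Fin 3), IsWeakDifferenceTerm.{u, v, w} L E wt) :
    ∀ (A : Type w) [L.Structure A], SatisfiesEqs L A E →
      ∀ α β : A → A → Prop, IsCongruence L A α → IsCongruence L A β →
        (Centralizes L A α α (fun a b => α a b ∧ β a b) ↔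
          Centralizes L A (Relation.TransGen fun a b => α a b ∨ β a b)
            (Relation.TransGen fun a b => α a b ∨ β a b) β) := by
  obtain ⟨d, hd⟩ := hW
  intro A _ hE α β hα hβ
  constructor
  · intro hC
    have hδ := hα.inf hβ
    have hsub : ∀ {x y}, α x y → Relation.Comp β (Relation.Comp α β) x y := fun {x y} h =>
      ⟨x, hβ.1.1 x, y, h, hβ.1.1 y⟩
    have maltsev : ∀ {x y}, α x y → β (d.realize ![x, x, y]) y ∧ β (d.realize ![y, x, x]) y :=
      fun h => (hd.maltsev_of_centralizes hE hα hδ (fun _ _ h => h.1) hC h).imp And.right And.right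
    have cong : ∀ {x y z x' y' z'}, β x x' → β y y' → β z z' →
        β (d.realize ![x, y, z]) (d.realize ![x', y', z']) := by
      intro x y z x' y' z' hx hy hz
      refine hβ.1.2.2.realize d fun i => ?_
      fin_cases i
      exacts [hx, hy, hz]
    have hT : IsAffineTolerance d (Relation.Comp β (Relation.Comp α β)) β :=
      { isTolerance :=
          ⟨fun x => hsub (hα.1.1 x),
            fun x y ⟨x', hx, y', hxy, hy⟩ =>
              ⟨y', hβ.1.2.1 hy, x', hα.1.2.1 hxy, hβ.1.2.1 hx⟩,
            hβ.1.2.2.comp (hα.1.2.2.comp hβ.1.2.2)⟩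
        termCondition := (hC.termCondition hα.1.1).mod hα hβ
        left := fun ⟨_, hx, _, hxy, hy⟩ =>
          hβ.2 (cong hx hx (hβ.1.2.1 hy)) (hβ.2 (maltsev hxy).1 hy)
        right := fun ⟨_, hx, _, hxy, hy⟩ =>
          hβ.2 (cong (hβ.1.2.1 hy) hx hx) (hβ.2 (maltsev hxy).2 hy) }
    have hle : ∀ x y, Relation.TransGen (fun a b => α a b ∨ β a b) x y →
        Relation.TransGen (Relation.Comp β (Relation.Comp α β)) x y := fun x y h =>
      
      Relation.TransGen.mono (fun x y h => h.elim hsub fun h => ⟨y, h, y, hα.1.1 y, hβ.1.1 y⟩)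
        x y h
    exact (hT.centralizes_transGen hβ).mono hle hle
  · intro hC
    have hle : ∀ x y, α x y → Relation.TransGen (fun a b => α a b ∨ β a b) x y :=
      fun _ _ h => .single (.inl h)
    exact (hC.mono hle hle).inf_self hα
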